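/- For any real numbers a_{ij}, b_{ij}, c_{ij}, d_{ij} (i,j ∈ [n]), we have ∑_{i,j,k,l} a_{ij} b_{jk} c_{kl} d_{li} ≤ sqrt( (∑ a_{ij}²)(∑ b_{ij}²)(∑ c_{ij}²)(∑ d_{ij}²) ). -/

import Mathlib

lemma frob_mul (n : ℕ) (a b : Fin n → Fin n → ℝ) :
    ∑ i : Fin n, ∑ k : Fin n, (∑ j : Fin n, a i j * b j k) ^ 2 ≤
      (∑ i : Fin n, ∑ j : Fin n, a i j ^ 2) * (∑ i : Fin n, ∑ j : Fin n, b i j ^ 2) := by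
  rw [Finset.sum_comm (f := fun i j => b i j ^ 2), Finset.sum_mul_sum]
  refine Finset.sum_le_sum fun i _ => Finset.sum_le_sum fun k _ => ?_
  exact Finset.sum_mul_sq_le_sq_mul_sq Finset.univ (fun j => a i j) (fun j => b j k)

theorem cyclic_quadruple_cauchy_schwarz (n : ℕ) (a b c d : Fin n → Fin n → ℝ) :
    ∑ i : Fin n, ∑ j : Fin n, ∑ k : Fin n, ∑ l : Fin n,
        a i j * b j k * c k l * d l i ≤
      Real.sqrt ((∑ i : Fin n, ∑ j : Fin n, a i j ^ 2) *
        (∑ i : Fin n, ∑ j : Fin n, b i j ^ 2) *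
        (∑ i : Fin n, ∑ j : Fin n, c i j ^ 2) *
        (∑ i : Fin n, ∑ j : Fin n, d i j ^ 2)) := by
  apply Real.le_sqrt_of_sq_le
  have h : ∑ i : Fin n, ∑ j : Fin n, ∑ k : Fin n, ∑ l : Fin n,
        a i j * b j k * c k l * d l i =
      ∑ p : Fin n × Fin n, (∑ j, a p.1 j * b j p.2) * (∑ l, c p.2 l * d l p.1) := by
    rw [Fintype.sum_prod_type]
    refine Finset.sum_congr rfl fun i _ => ?_
    rw [Finset.sum_comm]
    refine Finset.sum_congr rfl fun k _ => ?_
    rw [Finset.sum_mul_sum]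
    refine Finset.sum_congr rfl fun j _ => Finset.sum_congr rfl fun l _ => ?_
    ring
  rw [h]
  refine (Finset.sum_mul_sq_le_sq_mul_sq _ _ _).trans ?_
  rw [mul_assoc (_ * _)]
  refine mul_le_mul ?_ ?_ (by positivity) (by positivity)
  · rw [Fintype.sum_prod_type]
    exact frob_mul n a b
  · rw [Fintype.sum_prod_type, Finset.sum_comm]
    exact frob_mul n c d
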